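/- Let G be a group of order m², and let H₁, …, H_t be subgroups of G, each of order m, such that H_i ∩ H_j = {1} for i ≠ j. Then S = (H₁ ∪ ⋯ ∪ H_t) \ {1} is a regular partial difference set in G with latin square parameters (m², t(m−1), t²−3t+m, t(t−1)). -/

import Mathlib

/-- `S` is a `(v,k,λ,μ)` partial difference set in the finite group `G`. -/
def IsPDS {G : Type*} [Group G] [Fintype G] [DecidableEq G] (S : Finset G)
    (v k : ℕ) (l m : ℤ) : Prop :=
  Fintype.card G = v ∧ S.card = k ∧
  ∀ g : G, g ≠ 1 →
    ((((S ×ˢ S).filter (fun p => p.1 * p.2⁻¹ = g)).card : ℤ) = if g ∈ S then l else m)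

open scoped Classical

theorem pcp_exists_unique {G : Type*} [Group G] [Fintype G] (m : ℕ)
    (hG : Fintype.card G = m ^ 2) (A B : Subgroup G) (hA : Nat.card A = m) (hB : Nat.card B = m)
    (h : A ⊓ B = ⊥) (g : G) :
    (Finset.univ.filter (fun b : G => g * b ∈ A ∧ b ∈ B)).card = 1 := by
  have inj : Function.Injective (fun p : A × B => (p.1 : G) * (p.2 : G)⁻¹) := by
    rintro ⟨a, b⟩ ⟨c, d⟩ hh
    have hh : (a : G) * (b : G)⁻¹ = c * (d : G)⁻¹ := hh
    have e : (c : G)⁻¹ * a = (d : G)⁻¹ * b := by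
      rw [inv_mul_eq_iff_eq_mul, ← mul_assoc, ← hh]; simp
    have h1 : (c : G)⁻¹ * a ∈ A ⊓ B :=
      ⟨A.mul_mem (A.inv_mem c.2) a.2, by rw [e]; exact B.mul_mem (B.inv_mem d.2) b.2⟩
    rw [h, Subgroup.mem_bot] at h1
    have h2 := h1
    rw [e] at h2
    rw [inv_mul_eq_one] at h1 h2
    exact Prod.ext (Subtype.ext h1.symm) (Subtype.ext h2.symm)
  have bij := (Fintype.bijective_iff_injective_and_card
    (fun p : A × B => (p.1 : G) * (p.2 : G)⁻¹)).2 ⟨inj, by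
      rw [← Nat.card_eq_fintype_card, Nat.card_prod, hA, hB, hG, sq]⟩
  obtain ⟨⟨a, b⟩, hab, -⟩ := bij.existsUnique g
  have hab : (a : G) * (b : G)⁻¹ = g := hab
  rw [Finset.card_eq_one]
  refine ⟨b, ?_⟩
  ext x
  simp only [Finset.mem_filter, Finset.mem_univ, true_and, Finset.mem_singleton]
  constructor
  · rintro ⟨hx1, hx2⟩
    have := @inj (⟨g * x, hx1⟩, ⟨x, hx2⟩) (a, b) (by simp [hab])
    exact congrArg (fun p : A × B => (p.2 : G)) this
  · rintro rfl
    refine ⟨?_, b.2⟩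
    rw [← hab]; simp

theorem pcp_conv {G : Type*} [Group G] [Fintype G] (m t : ℕ)
    (hG : Fintype.card G = m ^ 2)
    (H : Fin t → Subgroup G)
    (hH : ∀ i, Nat.card (H i) = m)
    (hmeet : ∀ i j, i ≠ j → H i ⊓ H j = ⊥) (g : G) (i j : Fin t) :
    ∑ b : G, (if g * b ∈ H i then (1 : ℤ) else 0) * (if b ∈ H j then 1 else 0)
      = 1 + if i = j then m * (if g ∈ H i then (1 : ℤ) else 0) - 1 else 0 := by
  have e : ∀ b : G, (if g * b ∈ H i then (1 : ℤ) else 0) * (if b ∈ H j then 1 else 0)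
      = if g * b ∈ H i ∧ b ∈ H j then 1 else 0 := by
    intro b; split_ifs <;> simp_all
  simp_rw [e]
  rw [Finset.sum_boole]
  by_cases hij : i = j
  · subst hij
    by_cases hg : g ∈ H i
    · have : (Finset.univ.filter (fun b : G => g * b ∈ H i ∧ b ∈ H i)).card = m := by
        rw [← hH i, Nat.card_eq_fintype_card, Fintype.card_subtype]
        congr 1
        ext b
        simp [Subgroup.mul_mem_cancel_left, hg]
      rw [this]; simp [hg]
    · have : (Finset.univ.filter (fun b : G => g * b ∈ H i ∧ b ∈ H i)) = ∅ := by
        ext b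
        simp only [Finset.mem_filter, Finset.mem_univ, true_and, Finset.notMem_empty, iff_false]
        rintro ⟨h1, h2⟩
        exact hg (((H i).mul_mem_cancel_right h2).1 h1)
      rw [this]; simp [hg]
  · rw [pcp_exists_unique m hG _ _ (hH i) (hH j) (hmeet i j hij)]
    simp [hij]

theorem pcp_ind {G : Type*} [Group G] [DecidableEq G] (t : ℕ)
    (H : Fin t → Subgroup G)
    (hmeet : ∀ i j, i ≠ j → H i ⊓ H j = ⊥) (x : G) :
    (if x ≠ 1 ∧ ∃ i, x ∈ H i then (1 : ℤ) else 0)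
      = ∑ i, ((if x ∈ H i then (1 : ℤ) else 0) - if x = 1 then 1 else 0) := by
  by_cases hx : x = 1
  · subst hx; simp
  · by_cases hi : ∃ i, x ∈ H i
    · obtain ⟨i, hi⟩ := hi
      rw [if_pos ⟨hx, i, hi⟩, Finset.sum_eq_single i]
      · simp [hi, hx]
      · intro j _ hj
        have : x ∉ H j := by
          intro hxj
          have h1 : x ∈ H j ⊓ H i := ⟨hxj, hi⟩
          rw [hmeet j i hj, Subgroup.mem_bot] at h1
          exact hx h1
        simp [this, hx]
      · simp
    · rw [if_neg (by tauto)]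
      push Not at hi
      simp [hi, hx]

/-- Let `G` be a group of order `m²` with subgroups `H₁, …, H_t`, each of order `m`,
pairwise meeting only in the identity.  Then `S = (H₁ ∪ ⋯ ∪ H_t) \ {1}` is a regular
partial difference set in `G` with latin square parameters
`(m², t(m−1), t²−3t+m, t(t−1))`. -/
theorem partial_congruence_partition_pds
    {G : Type*} [Group G] [Fintype G] [DecidableEq G] (m t : ℕ)
    (hG : Fintype.card G = m ^ 2)
    (H : Fin t → Subgroup G)
    (hH : ∀ i, Nat.card (H i) = m)
    (hmeet : ∀ i j, i ≠ j → H i ⊓ H j = ⊥) :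
    IsPDS (Finset.univ.filter (fun g : G => g ≠ 1 ∧ ∃ i, g ∈ H i))
      (m ^ 2) (t * (m - 1)) ((t : ℤ) ^ 2 - 3 * t + m) ((t : ℤ) * ((t : ℤ) - 1)) ∧
    (1 : G) ∉ Finset.univ.filter (fun g : G => g ≠ 1 ∧ ∃ i, g ∈ H i) := by
  refine ⟨⟨hG, ?_, ?_⟩, by simp⟩
  · have hm : 1 ≤ m := by
      have := Fintype.card_pos (α := G)
      rw [hG] at this
      exact Nat.pos_of_ne_zero (by rintro rfl; simp at this)
    have key : ((Finset.univ.filter (fun g : G => g ≠ 1 ∧ ∃ i, g ∈ H i)).card : ℤ)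
        = t * ((m : ℤ) - 1) := by
      rw [← Finset.sum_boole]
      simp_rw [pcp_ind t H hmeet]
      rw [Finset.sum_comm]
      have : ∀ i, ∑ x : G, ((if x ∈ H i then (1 : ℤ) else 0) - if x = 1 then 1 else 0)
          = (m : ℤ) - 1 := by
        intro i
        rw [Finset.sum_sub_distrib, Finset.sum_boole, ← hH i, Nat.card_eq_fintype_card,
          Fintype.card_subtype]
        simp
      simp [this]
      ring
    zify [hm]
    convert key
  · intro g hg
    have count : (((((Finset.univ.filter (fun g : G => g ≠ 1 ∧ ∃ i, g ∈ H i)) ×ˢ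
        (Finset.univ.filter (fun g : G => g ≠ 1 ∧ ∃ i, g ∈ H i))).filter
          (fun p => p.1 * p.2⁻¹ = g)).card : ℕ) : ℤ)
        = ∑ b : G, (if g * b ≠ 1 ∧ ∃ i, g * b ∈ H i then (1 : ℤ) else 0)
            * (if b ≠ 1 ∧ ∃ i, b ∈ H i then (1 : ℤ) else 0) := by
      have e : ∀ b : G, (if g * b ≠ 1 ∧ ∃ i, g * b ∈ H i then (1 : ℤ) else 0)
            * (if b ≠ 1 ∧ ∃ i, b ∈ H i then (1 : ℤ) else 0)
          = if (g * b ≠ 1 ∧ ∃ i, g * b ∈ H i) ∧ (b ≠ 1 ∧ ∃ i, b ∈ H i) then 1 else 0 := by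
        intro b
        rw [ite_and (g * b ≠ 1 ∧ ∃ i, g * b ∈ H i), ite_mul, one_mul, zero_mul]
      simp_rw [e]
      rw [Finset.sum_boole]
      congr 1
      refine Finset.card_bij' (fun p _ => p.2) (fun b _ => (g * b, b)) ?_ ?_ ?_ ?_
      · rintro ⟨a, b⟩ h
        simp only [Finset.mem_filter, Finset.mem_product, Finset.mem_univ, true_and] at h ⊢
        obtain ⟨⟨h1, h2⟩, rfl⟩ := h
        rw [inv_mul_cancel_right]
        exact ⟨h1, h2⟩
      · intro b h
        simp only [Finset.mem_filter, Finset.mem_product, Finset.mem_univ, true_and] at h ⊢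
        exact ⟨h, by simp⟩
      · rintro ⟨a, b⟩ h
        simp only [Finset.mem_filter] at h
        obtain ⟨-, rfl⟩ := h
        simp
      · intro b h
        rfl
    have term : ∀ i j, ∑ b : G,
        ((if g * b ∈ H i then (1 : ℤ) else 0) - if g * b = 1 then 1 else 0)
          * ((if b ∈ H j then (1 : ℤ) else 0) - if b = 1 then 1 else 0)
        = (1 + if i = j then m * (if g ∈ H i then (1 : ℤ) else 0) - 1 else 0)
          - (if g ∈ H j then (1 : ℤ) else 0) - (if g ∈ H i then (1 : ℤ) else 0) := by
      intro i j
      rw [← pcp_conv m t hG H hH hmeet g i j]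
      simp_rw [sub_mul, mul_sub, Finset.sum_sub_distrib]
      have a1 : ∑ b : G, (if g * b ∈ H i then (1 : ℤ) else 0) * (if b = 1 then 1 else 0)
          = if g ∈ H i then 1 else 0 := by simp
      have a2 : ∑ b : G, (if g * b = 1 then (1 : ℤ) else 0) * (if b ∈ H j then 1 else 0)
          = if g ∈ H j then 1 else 0 := by
        rw [Finset.sum_eq_single g⁻¹]
        · simp
        · intro b _ hb
          have : g * b ≠ 1 := fun h => hb (eq_inv_of_mul_eq_one_right h)
          simp [this]
        · simp
      have a3 : ∑ b : G, (if g * b = 1 then (1 : ℤ) else 0) * (if b = 1 then 1 else 0)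
          = 0 := by
        simp [hg]
      rw [a1, a2, a3]
      ring
    have hc := pcp_ind t H hmeet g
    simp only [hg, if_false, sub_zero] at hc
    have total : ∑ b : G, (if g * b ≠ 1 ∧ ∃ i, g * b ∈ H i then (1 : ℤ) else 0)
            * (if b ≠ 1 ∧ ∃ i, b ∈ H i then (1 : ℤ) else 0)
        = t * (t - 1) + (m - 2 * t) * ∑ i, (if g ∈ H i then (1 : ℤ) else 0) := by
      simp_rw [pcp_ind t H hmeet, Finset.sum_mul_sum]
      rw [Finset.sum_comm]
      have : ∀ i : Fin t, ∑ b : G, ∑ j : Fin t,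
        ((if g * b ∈ H i then (1 : ℤ) else 0) - if g * b = 1 then 1 else 0)
          * ((if b ∈ H j then (1 : ℤ) else 0) - if b = 1 then 1 else 0)
          = (t - 1) + m * (if g ∈ H i then (1 : ℤ) else 0)
            - ∑ j, (if g ∈ H j then (1 : ℤ) else 0) - t * (if g ∈ H i then (1 : ℤ) else 0) := by
        intro i
        rw [Finset.sum_comm]
        simp_rw [term]
        rw [Finset.sum_sub_distrib, Finset.sum_sub_distrib, Finset.sum_add_distrib,
          Finset.sum_ite_eq, Finset.sum_const, Finset.sum_const, Finset.card_univ,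
          Fintype.card_fin, if_pos (Finset.mem_univ i)]
        simp only [nsmul_eq_mul]
        ring
      simp_rw [this]
      rw [Finset.sum_sub_distrib, Finset.sum_sub_distrib, Finset.sum_add_distrib,
        ← Finset.mul_sum, ← Finset.mul_sum, Finset.sum_const, Finset.sum_const, Finset.card_univ,
          Fintype.card_fin]
      simp only [nsmul_eq_mul]
      ring
    rw [← hc] at total
    have fin := count.trans total
    have goal2 : t * ((t : ℤ) - 1) + (m - 2 * t) *
        (if ¬ False ∧ ∃ i, g ∈ H i then (1 : ℤ) else 0)
        = if g ∈ Finset.univ.filter (fun g : G => g ≠ 1 ∧ ∃ i, g ∈ H i)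
          then ((t : ℤ) ^ 2 - 3 * t + m) else ((t : ℤ) * ((t : ℤ) - 1)) := by
      by_cases h : ∃ i, g ∈ H i
      · rw [if_pos ⟨not_false, h⟩, if_pos (by simp [hg, h])]
        ring
      · rw [if_neg (by tauto), if_neg (by simp [h])]
        ring
    convert fin.trans (Eq.trans ?_ goal2) using 1
    simp [hg]
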